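/- arXiv:2201.00759 — 7 statements merged into one kernel-verified Lean document; each statement's English description precedes it below -/
import Mathlib

section
/- In the followers' sub-game G_F, there exists a Nash equilibrium. That is, there exists a strategy profile r* = (r*_1, ..., r*_N), with r*_n in the strategy set S_n for each follower n, such that for every follower n and every alternative strategy r'_n in S_n, U_n(r*_n, r*_{-n}) ≥ U_n(r'_n, r*_{-n}). -/
open scoped BigOperators

/-- The strategy set of a follower with capacity `Rn`: nonnegative contributions to each
of the `M` shards summing to at most `Rn`. -/
def StrategySet (M : ℕ) (Rn : ℝ) : Set (Fin M → ℝ) :=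
  {r | (∀ m, 0 ≤ r m) ∧ ∑ m, r m ≤ Rn}

/-- The utility of follower `n` under profile `r`: the pay-per-share reward over all shards
minus the operational cost.  (In Lean, division by zero yields zero, which matches the
convention that a term is `0` when `∑ i, r i m = 0`.) -/
noncomputable def Utility {N M : ℕ} (P : Fin M → ℝ) (C : Fin N → ℝ)
    (r : Fin N → Fin M → ℝ) (n : Fin N) : ℝ :=
  ∑ m, P m * r n m / (∑ i, r i m) - C n * ∑ m, r n m

open scoped Pointwise in
lemma ky_fan_aux {E : Type*} [AddCommGroup E] [Module ℝ E] [TopologicalSpace E]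
    (K : Set E) (hK : IsCompact K) (hconv : Convex ℝ K) (hne : K.Nonempty)
    (Φ : E → E → ℝ)
    (h1 : ∀ y ∈ K, ContinuousOn (fun x => Φ x y) K)
    (h2 : ∀ y ∈ K, ConvexOn ℝ K (fun x => Φ x y))
    (h3 : ∀ x ∈ K, ConcaveOn ℝ K (Φ x))
    (h4 : ∀ x ∈ K, Φ x x ≤ 0) (s : Finset E) (hs : ∀ y ∈ s, y ∈ K) :
    ∃ x ∈ K, ∀ y ∈ s, Φ x y ≤ 0 := by
  classical
  by_contra hcon
  push Not at hcon
  let F : E → (s → ℝ) := fun x i => Φ x i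
  have hF : ContinuousOn F K := by
    refine continuousOn_pi.2 fun i => ?_
    exact h1 i (hs i i.2)
  let A : Set (s → ℝ) := {v | ∃ x ∈ K, ∀ i, F x i ≤ v i}
  have hA : A = F '' K + Set.Ici (0 : s → ℝ) := by
    ext v
    constructor
    · rintro ⟨x, hx, hv⟩
      refine Set.mem_add.2 ⟨F x, ⟨x, hx, rfl⟩, v - F x, ?_, by simp⟩
      intro i
      have := hv i
      simp only [Pi.zero_apply, Pi.sub_apply]
      linarith
    · rintro ⟨_, ⟨x, hx, rfl⟩, w, hw, rfl⟩
      refine ⟨x, hx, fun i => ?_⟩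
      have := hw i
      simp only [Pi.zero_apply, Pi.add_apply] at *
      linarith
  have hAc : IsClosed A := by
    rw [hA]
    exact (isClosed_Ici).add_left_of_isCompact (hK.image_of_continuousOn hF)
  have hAconv : Convex ℝ A := by
    rintro v ⟨x, hx, hv⟩ w ⟨z, hz, hw⟩ a b ha hb hab
    refine ⟨a • x + b • z, hconv hx hz ha hb hab, fun i => ?_⟩
    have := (h2 i (hs i i.2)).2 hx hz ha hb hab
    have e1 := mul_le_mul_of_nonneg_left (hv i) ha
    have e2 := mul_le_mul_of_nonneg_left (hw i) hb
    simp only [F, smul_eq_mul, Pi.add_apply, Pi.smul_apply] at *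
    linarith
  have h0 : (0 : s → ℝ) ∉ A := by
    rintro ⟨x, hx, hv⟩
    obtain ⟨y, hy, hpos⟩ := hcon x hx
    have := hv ⟨y, hy⟩
    simp only [F, Pi.zero_apply] at this
    linarith
  obtain ⟨f, u, hfu, hu⟩ := geometric_hahn_banach_point_closed hAconv hAc h0
  rw [map_zero] at hfu
  let c : s → ℝ := fun i => f (Pi.single i 1)
  have hf : ∀ v, f v = ∑ i, v i * c i := by
    intro v
    conv_lhs => rw [pi_eq_sum_univ' v]
    rw [map_sum]
    refine Finset.sum_congr rfl fun i _ => ?_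
    rw [map_smul, smul_eq_mul]
  obtain ⟨x0, hx0⟩ := hne
  have hc : ∀ i, 0 ≤ c i := by
    intro i
    by_contra hneg
    push Not at hneg
    have hB : ∀ t : ℝ, 0 ≤ t → 0 < f (F x0) + t * c i := by
      intro t ht
      have := hu (F x0 + t • Pi.single i 1) ⟨x0, hx0, fun j => by
        have : 0 ≤ (Pi.single i 1 : s → ℝ) j := by
          by_cases h : j = i
          · subst h; simp
          · simp [h]
        have := mul_nonneg ht this
        simp only [Pi.add_apply, Pi.smul_apply, smul_eq_mul]
        linarith⟩
      rw [map_add, map_smul, smul_eq_mul] at this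
      show 0 < f (F x0) + t * f (Pi.single i 1)
      linarith
    have hp := hB 0 le_rfl
    have := hB (f (F x0) / (-c i)) (div_nonneg (by linarith) (by linarith))
    have e : f (F x0) / (-c i) * c i = - f (F x0) := by
      rw [div_neg, neg_mul, div_mul_cancel₀ _ hneg.ne]
    rw [e] at this
    linarith
  have hsum : 0 < ∑ i, c i := by
    refine lt_of_le_of_ne (Finset.sum_nonneg fun i _ => hc i) fun h => ?_
    have hz := (Finset.sum_eq_zero_iff_of_nonneg (fun i _ => hc i)).1 h.symm
    have := hu (F x0) ⟨x0, hx0, fun i => le_rfl⟩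
    rw [hf, Finset.sum_eq_zero (fun i hi => by rw [hz i hi, mul_zero])] at this
    linarith
  have hxm : Finset.univ.centerMass c (fun i : s => (i : E)) ∈ K :=
    hconv.centerMass_mem (fun i _ => hc i) hsum (fun i _ => hs i i.2)
  set x := Finset.univ.centerMass c (fun i : s => (i : E)) with hxdef
  have hj := (h3 x hxm).le_map_centerMass (t := Finset.univ) (w := c)
    (p := fun i : s => (i : E)) (fun i _ => hc i) hsum (fun i _ => hs i i.2)
  rw [← hxdef] at hj
  have hle := hj.trans (h4 x hxm)
  have hpos := hu (F x) ⟨x, hxm, fun i => le_rfl⟩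
  rw [hf] at hpos
  have : 0 < Finset.univ.centerMass c (Φ x ∘ fun i : s => (i : E)) := by
    rw [Finset.centerMass, smul_eq_mul]
    refine mul_pos (inv_pos.2 hsum) ?_
    have e : ∑ i, c i • (Φ x ∘ fun i : s => (i : E)) i = ∑ i, F x i * c i :=
      Finset.sum_congr rfl fun i _ => by simp [F, mul_comm]
    rw [e]; linarith
  linarith

lemma ky_fan {E : Type*} [AddCommGroup E] [Module ℝ E] [TopologicalSpace E] [T2Space E]
    (K : Set E) (hK : IsCompact K) (hconv : Convex ℝ K) (hne : K.Nonempty)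
    (Φ : E → E → ℝ)
    (h1 : ∀ y ∈ K, ContinuousOn (fun x => Φ x y) K)
    (h2 : ∀ y ∈ K, ConvexOn ℝ K (fun x => Φ x y))
    (h3 : ∀ x ∈ K, ConcaveOn ℝ K (Φ x))
    (h4 : ∀ x ∈ K, Φ x x ≤ 0) :
    ∃ x ∈ K, ∀ y ∈ K, Φ x y ≤ 0 := by
  classical
  have := hK.inter_iInter_nonempty (fun y : K => {x | x ∈ K ∧ Φ x y ≤ 0}) (fun y => by
      have := (h1 y y.2).preimage_isClosed_of_isClosed hK.isClosed (isClosed_Iic (a := (0:ℝ)))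
      exact this) (fun u => by
      obtain ⟨x, hx, h⟩ := ky_fan_aux K hK hconv hne Φ h1 h2 h3 h4 (u.image Subtype.val)
        (by intro y hy; obtain ⟨z, _, rfl⟩ := Finset.mem_image.1 hy; exact z.2)
      refine ⟨x, hx, Set.mem_iInter₂.2 fun y hy => ⟨hx, h y (Finset.mem_image_of_mem _ hy)⟩⟩)
  obtain ⟨x, hx, h⟩ := this
  exact ⟨x, hx, fun y hy => (Set.mem_iInter.1 h ⟨y, hy⟩).2⟩

lemma inv_convex {u v a b : ℝ} (hu : 0 < u) (hv : 0 < v) (ha : 0 ≤ a)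
    (hb : 0 ≤ b) (hab : a + b = 1) : (a * u + b * v)⁻¹ ≤ a * u⁻¹ + b * v⁻¹ := by
  have hw : 0 < a * u + b * v := by
    rcases ha.eq_or_lt with rfl | ha
    · have : b = 1 := by linarith
      subst this
      linarith
    · positivity
  have e : a * u⁻¹ + b * v⁻¹ = (a * v + b * u) / (u * v) := by field_simp
  rw [e, inv_eq_one_div, div_le_div_iff₀ hw (by positivity)]
  obtain rfl : b = 1 - a := by linarith
  nlinarith [mul_nonneg (mul_nonneg ha hb) (sq_nonneg (u - v))]

lemma share_convex {y s t a b : ℝ} (hy : 0 ≤ y) (hs : 0 ≤ s) (ht : 0 ≤ t) (ha : 0 ≤ a)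
    (hb : 0 ≤ b) (hab : a + b = 1) :
    y / (y + (a * s + b * t)) ≤ a * (y / (y + s)) + b * (y / (y + t)) := by
  rcases hy.eq_or_lt with rfl | hy
  · simp
  have h := inv_convex (u := y + s) (v := y + t) (by linarith) (by linarith) ha hb hab
  have e : a * (y + s) + b * (y + t) = y + (a * s + b * t) := by
    linear_combination y * hab
  rw [e] at h
  have := mul_le_mul_of_nonneg_left h hy.le
  simp only [div_eq_mul_inv]
  linarith

lemma share_concave {s x y a b : ℝ} (hs : 0 ≤ s) (hx : 0 ≤ x) (hy : 0 ≤ y) (ha : 0 ≤ a)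
    (hb : 0 ≤ b) (hab : a + b = 1) :
    a * (x / (x + s)) + b * (y / (y + s)) ≤ (a * x + b * y) / ((a * x + b * y) + s) := by
  have hz : 0 ≤ a * x + b * y := by positivity
  rcases hs.eq_or_lt with rfl | hs
  · simp only [add_zero]
    rcases hz.eq_or_lt with h | h
    · have h1 : a * x = 0 := by nlinarith [mul_nonneg ha hx, mul_nonneg hb hy]
      have h2 : b * y = 0 := by nlinarith [mul_nonneg ha hx, mul_nonneg hb hy]
      simp only [div_eq_mul_inv, ← mul_assoc, h1, h2]
      simp
    · rw [div_self h.ne']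
      have h1 := mul_le_mul_of_nonneg_left (div_self_le_one x) ha
      have h2 := mul_le_mul_of_nonneg_left (div_self_le_one y) hb
      linarith
  · have h := inv_convex (u := x + s) (v := y + s) (by linarith) (by linarith) ha hb hab
    have e : a * (x + s) + b * (y + s) = (a * x + b * y) + s := by
      linear_combination s * hab
    rw [e] at h
    have key : ∀ z : ℝ, 0 ≤ z → z / (z + s) = 1 - s * (z + s)⁻¹ := by
      intro z hz
      have : z + s ≠ 0 := by positivity
      field_simp
      ring
    rw [key x hx, key y hy, key _ hz]
    have := mul_le_mul_of_nonneg_left h hs.le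
    nlinarith

/-- Aggregate deviation function. -/
noncomputable def Agg {N M : ℕ} (P : Fin M → ℝ) (C : Fin N → ℝ)
    (x y : Fin N → Fin M → ℝ) : ℝ :=
  ∑ n, ∑ m, (P m * (y n m / (y n m + ∑ i ∈ Finset.univ.erase n, x i m))
    + (C n * x n m - C n * y n m)) - ∑ m, P m

lemma sum_split {N M : ℕ} (x : Fin N → Fin M → ℝ) (n : Fin N) (m : Fin M) :
    x n m + ∑ i ∈ Finset.univ.erase n, x i m = ∑ i, x i m :=
  Finset.add_sum_erase _ (fun i => x i m) (Finset.mem_univ n)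

lemma agg_diag {N M : ℕ} (P : Fin M → ℝ) (C : Fin N → ℝ) (x : Fin N → Fin M → ℝ) :
    Agg P C x x = ∑ m, P m * ((∑ i, x i m) / ∑ i, x i m) - ∑ m, P m := by
  unfold Agg
  simp only [sum_split, sub_self, add_zero]
  rw [Finset.sum_comm]
  simp only [← Finset.mul_sum, Finset.sum_div]

lemma utility_update {N M : ℕ} (P : Fin M → ℝ) (C : Fin N → ℝ) (x : Fin N → Fin M → ℝ)
    (n : Fin N) (r : Fin M → ℝ) :
    Utility P C (Function.update x n r) n =
      ∑ m, (P m * (r m / (r m + ∑ i ∈ Finset.univ.erase n, x i m)) - C n * r m) := by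
  unfold Utility
  rw [Finset.mul_sum, ← Finset.sum_sub_distrib]
  refine Finset.sum_congr rfl fun m _ => ?_
  rw [← sum_split _ n m, Function.update_self, mul_div_assoc]
  congr 4
  refine Finset.sum_congr rfl fun i hi => ?_
  rw [Function.update_of_ne (Finset.ne_of_mem_erase hi)]

lemma utility_self {N M : ℕ} (P : Fin M → ℝ) (C : Fin N → ℝ) (x : Fin N → Fin M → ℝ)
    (n : Fin N) :
    Utility P C x n =
      ∑ m, (P m * (x n m / (x n m + ∑ i ∈ Finset.univ.erase n, x i m)) - C n * x n m) := by
  rw [← utility_update, Function.update_eq_self]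

lemma profile_compact {N M : ℕ} (R : Fin N → ℝ) :
    IsCompact {r : Fin N → Fin M → ℝ | ∀ n, r n ∈ StrategySet M (R n)} := by
  have h : IsClosed {r : Fin N → Fin M → ℝ | ∀ n, r n ∈ StrategySet M (R n)} := by
    have e : {r : Fin N → Fin M → ℝ | ∀ n, r n ∈ StrategySet M (R n)} =
        ⋂ n, ((⋂ m, {r | 0 ≤ r n m}) ∩ {r | ∑ m, r n m ≤ R n}) := by
      ext r
      simp [StrategySet]
    rw [e]
    refine isClosed_iInter fun n => IsClosed.inter (isClosed_iInter fun m => ?_) ?_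
    · exact isClosed_le (by fun_prop) (by fun_prop)
    · exact isClosed_le (by fun_prop) (by fun_prop)
  refine (isCompact_Icc (a := (0 : Fin N → Fin M → ℝ)) (b := fun n _ => R n)).of_isClosed_subset
    h fun r hr => ⟨fun n m => (hr n).1 m, fun n m => ?_⟩
  exact (Finset.single_le_sum (f := r n) (fun i _ => (hr n).1 i) (Finset.mem_univ m)).trans (hr n).2

lemma strategySet_convex (M : ℕ) (R : ℝ) : Convex ℝ (StrategySet M R) := by
  rintro x ⟨hx, hx'⟩ y ⟨hy, hy'⟩ a b ha hb hab
  refine ⟨fun m => ?_, ?_⟩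
  · have := hx m
    have := hy m
    simp only [Pi.add_apply, Pi.smul_apply, smul_eq_mul]
    positivity
  · simp only [Pi.add_apply, Pi.smul_apply, smul_eq_mul, Finset.sum_add_distrib, ← Finset.mul_sum]
    have e1 := mul_le_mul_of_nonneg_left hx' ha
    have e2 := mul_le_mul_of_nonneg_left hy' hb
    have : a * R + b * R = R := by rw [← add_mul, hab, one_mul]
    linarith

lemma profile_convex {N M : ℕ} (R : Fin N → ℝ) :
    Convex ℝ {r : Fin N → Fin M → ℝ | ∀ n, r n ∈ StrategySet M (R n)} :=
  fun _ hx _ hy _ _ ha hb hab n => strategySet_convex M (R n) (hx n) (hy n) ha hb hab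

lemma exists_agg {N M : ℕ} (R C : Fin N → ℝ) (P : Fin M → ℝ)
    (hR : ∀ n, 0 < R n) (hP : ∀ m, 0 < P m) :
    ∃ x : Fin N → Fin M → ℝ, (∀ n, x n ∈ StrategySet M (R n)) ∧
      ∀ y : Fin N → Fin M → ℝ, (∀ n, y n ∈ StrategySet M (R n)) → Agg P C x y ≤ 0 := by
  have hsn : ∀ x : Fin N → Fin M → ℝ, (∀ n, x n ∈ StrategySet M (R n)) → ∀ n m,
      0 ≤ ∑ i ∈ Finset.univ.erase n, x i m :=
    fun x hx n m => Finset.sum_nonneg fun i _ => (hx i).1 m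
  refine ky_fan {r : Fin N → Fin M → ℝ | ∀ n, r n ∈ StrategySet M (R n)} (profile_compact R)
    (profile_convex R) ⟨0, fun n => ⟨fun m => le_rfl, by simpa using (hR n).le⟩⟩ (Agg P C)
    ?_ ?_ ?_ ?_
  · intro y hy
    unfold Agg
    refine ContinuousOn.sub (continuousOn_finsetSum _ fun n _ =>
      continuousOn_finsetSum _ fun m _ => ContinuousOn.add ?_ (by fun_prop)) (by fun_prop)
    rcases ((hy n).1 m).eq_or_lt with h | h
    · simp only [← h, zero_div]
      fun_prop
    · refine continuousOn_const.mul (ContinuousOn.div (by fun_prop) (by fun_prop) ?_)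
      intro x hx
      have := hsn x hx n m
      positivity
  · intro y hy
    refine ⟨profile_convex R, fun x hx z hz a b ha hb hab => ?_⟩
    have hc : ∑ m, P m = a * ∑ m, P m + b * ∑ m, P m := by rw [← add_mul, hab, one_mul]
    unfold Agg
    rw [smul_eq_mul, smul_eq_mul, mul_sub, mul_sub]
    have : ∀ u v w k : ℝ, u ≤ v + w → ∀ q r : ℝ, k = q + r → u - k ≤ v - q + (w - r) := by
      intros; linarith
    refine this _ _ _ _ ?_ _ _ hc
    simp only [Finset.mul_sum, ← Finset.sum_add_distrib]
    refine Finset.sum_le_sum fun n _ => Finset.sum_le_sum fun m _ => ?_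
    have h := mul_le_mul_of_nonneg_left
      (share_convex ((hy n).1 m) (hsn x hx n m) (hsn z hz n m) ha hb hab) (hP m).le
    simp only [Pi.add_apply, Pi.smul_apply, smul_eq_mul, Finset.sum_add_distrib,
      ← Finset.mul_sum]
    linear_combination h + C n * y n m * hab
  · intro x hx
    refine ⟨profile_convex R, fun y hy z hz a b ha hb hab => ?_⟩
    have hc : ∑ m, P m = a * ∑ m, P m + b * ∑ m, P m := by rw [← add_mul, hab, one_mul]
    unfold Agg
    rw [smul_eq_mul, smul_eq_mul, mul_sub, mul_sub]
    have : ∀ u v w k : ℝ, v + w ≤ u → ∀ q r : ℝ, k = q + r → v - q + (w - r) ≤ u - k := by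
      intros; linarith
    refine this _ _ _ _ ?_ _ _ hc
    simp only [Finset.mul_sum, ← Finset.sum_add_distrib]
    refine Finset.sum_le_sum fun n _ => Finset.sum_le_sum fun m _ => ?_
    have h := mul_le_mul_of_nonneg_left
      (share_concave (hsn x hx n m) ((hy n).1 m) ((hz n).1 m) ha hb hab) (hP m).le
    simp only [Pi.add_apply, Pi.smul_apply, smul_eq_mul]
    linear_combination h + C n * x n m * hab
  · intro x hx
    rw [agg_diag, sub_nonpos]
    refine Finset.sum_le_sum fun m _ => ?_
    have := mul_le_mul_of_nonneg_left (div_self_le_one (∑ i, x i m)) (hP m).le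
    linarith

lemma agg_pos {N M : ℕ} (hN : 2 ≤ N) (R C : Fin N → ℝ) (P : Fin M → ℝ)
    (hR : ∀ n, 0 < R n) (hP : ∀ m, 0 < P m) (hM : 1 ≤ M)
    (x : Fin N → Fin M → ℝ) (hx : ∀ n, x n ∈ StrategySet M (R n))
    (h : ∀ y : Fin N → Fin M → ℝ, (∀ n, y n ∈ StrategySet M (R n)) → Agg P C x y ≤ 0)
    (m : Fin M) : 0 < ∑ i, x i m := by
  have hxn : ∀ m, 0 ≤ ∑ i, x i m := fun m => Finset.sum_nonneg fun i _ => (hx i).1 m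
  have hsn : ∀ n m, 0 ≤ ∑ i ∈ Finset.univ.erase n, x i m :=
    fun n m => Finset.sum_nonneg fun i _ => (hx i).1 m
  by_contra hm
  have hm0 : ∑ i, x i m = 0 := le_antisymm (not_lt.1 hm) (hxn m)
  have hMpos : (0 : ℝ) < M := by exact_mod_cast hM
  let w : Fin N → Fin M → ℝ := fun n _ => R n / M
  have hw : ∀ n, w n ∈ StrategySet M (R n) := fun n =>
    ⟨fun m => (div_pos (hR n) hMpos).le, by
      simp only [w, Finset.sum_const, Finset.card_univ, Fintype.card_fin, nsmul_eq_mul]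
      exact (mul_div_cancel₀ _ hMpos.ne').le⟩
  let D : ℝ := ∑ n, ∑ m, (C n * x n m - C n * w n m)
  have hbound : ∀ t : ℝ, 0 < t → t ≤ 1 →
      (1 - t) * ∑ k, P k + P m + t * D - ∑ k, P k ≤ 0 := by
    intro t ht ht1
    have hy := profile_convex R hx hw (sub_nonneg.2 ht1) ht.le (sub_add_cancel 1 t)
    refine le_trans ?_ (h _ hy)
    unfold Agg
    refine sub_le_sub_right ?_ _
    simp only [Finset.sum_add_distrib]
    refine add_le_add ?_ ?_
    · rw [Finset.sum_comm, Finset.mul_sum]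
      have hterm : ∀ k, (1 - t) * P k + (if k = m then P m else 0) ≤
          ∑ n, P k * (((1 - t) • x + t • w) n k / (((1 - t) • x + t • w) n k +
            ∑ i ∈ Finset.univ.erase n, x i k)) := by
        intro k
        have hpos : ∀ n, 0 < ((1 - t) • x + t • w) n k := by
          intro n
          have h1 := mul_nonneg (sub_nonneg.2 ht1) ((hx n).1 k)
          have h2 := mul_pos ht (div_pos (hR n) hMpos)
          simp only [Pi.add_apply, Pi.smul_apply, smul_eq_mul, w]
          linarith
        rcases (hxn k).eq_or_lt with hk | hk
        · have hz : ∀ n, ∑ i ∈ Finset.univ.erase n, x i k = 0 := by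
            intro n
            have := sum_split x n k
            have := (hx n).1 k
            have := hsn n k
            linarith
          have e : ∀ n, P k * (((1 - t) • x + t • w) n k / (((1 - t) • x + t • w) n k +
            ∑ i ∈ Finset.univ.erase n, x i k)) = P k := by
            intro n
            rw [hz, add_zero, div_self (hpos n).ne', mul_one]
          simp only [e, Finset.sum_const, Finset.card_univ, Fintype.card_fin, nsmul_eq_mul]
          have hN' : (2 : ℝ) ≤ N := by exact_mod_cast hN
          have hPk := hP k
          have : (if k = m then P m else 0) ≤ P k := by
            split_ifs with hkm
            · rw [hkm]
            · exact hPk.le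
          nlinarith
        · have hkm : k ≠ m := by
            rintro rfl
            linarith
          rw [if_neg hkm, add_zero]
          have e : (1 - t) * P k = ∑ n, P k * ((1 - t) * (x n k / ∑ i, x i k)) := by
            rw [← Finset.mul_sum, ← Finset.mul_sum, ← Finset.sum_div, div_self hk.ne']
            ring
          rw [e]
          refine Finset.sum_le_sum fun n _ => mul_le_mul_of_nonneg_left ?_ (hP k).le
          have h1 := share_concave (hsn n k) ((hx n).1 k) ((hw n).1 k) (sub_nonneg.2 ht1) ht.le
            (sub_add_cancel 1 t)
          have h2 : 0 ≤ t * (w n k / (w n k + ∑ i ∈ Finset.univ.erase n, x i k)) := by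
            have := (hw n).1 k
            have := hsn n k
            positivity
          rw [sum_split x n k] at h1
          simp only [Pi.add_apply, Pi.smul_apply, smul_eq_mul]
          linarith
      have := Finset.sum_le_sum fun k (_ : k ∈ Finset.univ) => hterm k
      rw [Finset.sum_add_distrib] at this
      simpa using this
    · simp only [D, Finset.mul_sum]
      refine le_of_eq (Finset.sum_congr rfl fun n _ => ?_)
      refine Finset.sum_congr rfl fun k _ => ?_
      simp only [Pi.add_apply, Pi.smul_apply, smul_eq_mul]
      ring
  have hQ : 0 < |D - ∑ k, P k| + P m := add_pos_of_nonneg_of_pos (abs_nonneg _) (hP m)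
  have hlim := hbound (P m / (2 * (|D - ∑ k, P k| + P m))) (by have := hP m; positivity) (by
    rw [div_le_one (by positivity)]
    have := abs_nonneg (D - ∑ k, P k)
    have := hP m
    linarith)
  set t := P m / (2 * (|D - ∑ k, P k| + P m)) with htdef
  have ht : 0 < t := by have := hP m; positivity
  have e : t * (|D - ∑ k, P k| + P m) = P m / 2 := by
    rw [htdef]; field_simp
  have h1 := mul_le_mul_of_nonneg_left (neg_abs_le (D - ∑ k, P k)) ht.le
  have h2 := mul_pos ht (hP m)
  have h3 := hP m
  nlinarith

/-- **Existence of a Nash equilibrium in the followers' sub-game `G_F`.**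
There exists a profile `r*` with `r*_n ∈ S_n` for every follower, such that no follower can
strictly improve its utility by unilaterally deviating within its strategy set. -/
theorem followers_subgame_exists_nash_equilibrium
    (N M : ℕ) (hN : 2 ≤ N) (hM : 1 ≤ M)
    (R C : Fin N → ℝ) (P : Fin M → ℝ)
    (hR : ∀ n, 0 < R n) (hC : ∀ n, 0 < C n) (hP : ∀ m, 0 < P m) :
    ∃ rstar : Fin N → Fin M → ℝ,
      (∀ n, rstar n ∈ StrategySet M (R n)) ∧
      ∀ n, ∀ r' ∈ StrategySet M (R n),
        Utility P C (Function.update rstar n r') n ≤ Utility P C rstar n := by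
  obtain ⟨x, hx, h⟩ := exists_agg R C P hR hP
  have hpos := agg_pos hN R C P hR hP hM x hx h
  refine ⟨x, hx, fun n r' hr' => ?_⟩
  have hy := h (Function.update x n r') (fun k => by
    by_cases hk : k = n
    · subst hk
      rwa [Function.update_self]
    · rw [Function.update_of_ne hk]
      exact hx k)
  have hd : Agg P C x x = 0 := by
    rw [agg_diag, sub_eq_zero]
    exact Finset.sum_congr rfl fun m _ => by rw [div_self (hpos m).ne', mul_one]
  rw [utility_update, utility_self]
  have key : Agg P C x (Function.update x n r') - Agg P C x x =
      ∑ m, (P m * (r' m / (r' m + ∑ i ∈ Finset.univ.erase n, x i m)) - C n * r' m) -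
      ∑ m, (P m * (x n m / (x n m + ∑ i ∈ Finset.univ.erase n, x i m)) - C n * x n m) := by
    unfold Agg
    rw [sub_sub_sub_cancel_right, ← Finset.sum_sub_distrib, Finset.sum_eq_single n]
    · rw [← Finset.sum_sub_distrib, ← Finset.sum_sub_distrib]
      refine Finset.sum_congr rfl fun m _ => ?_
      rw [Function.update_self]
      ring
    · intro k _ hk
      rw [Function.update_of_ne hk, sub_self]
    · simp
  linarith
end

section
/- In the followers' sub-game G_F, the Nash equilibrium is unique: if r* and r** are two strategy profiles such that, in each, every follower's strategy is a best response to the other followers' strategies within its strategy set, then r* = r**. -/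
open scoped BigOperators

/-- `r` is a Nash equilibrium of the followers' sub-game: every follower's strategy lies in
its strategy set and is a best response to the other followers' strategies. -/
def IsNashEquilibrium {N M : ℕ} (R C : Fin N → ℝ) (P : Fin M → ℝ)
    (r : Fin N → Fin M → ℝ) : Prop :=
  (∀ n, r n ∈ StrategySet M (R n)) ∧
  ∀ n, ∀ r' ∈ StrategySet M (R n),
    Utility P C (Function.update r n r') n ≤ Utility P C r n

noncomputable def brU {M : ℕ} (P A : Fin M → ℝ) (c : ℝ) (x : Fin M → ℝ) : ℝ :=
  ∑ m, P m * x m / (x m + A m) - c * ∑ m, x m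

lemma utility_update_eq {N M : ℕ} (P : Fin M → ℝ) (C : Fin N → ℝ)
    (r : Fin N → Fin M → ℝ) (n : Fin N) (x : Fin M → ℝ) :
    Utility P C (Function.update r n x) n
      = brU P (fun m => ∑ i ∈ Finset.univ.erase n, r i m) (C n) x := by
  unfold Utility brU
  have key : ∀ m, ∑ i, Function.update r n x i m
      = x m + ∑ i ∈ Finset.univ.erase n, r i m := by
    intro m
    rw [← Finset.add_sum_erase Finset.univ _ (Finset.mem_univ n)]
    congr 1
    · simp
    · apply Finset.sum_congr rfl
      intro i hi
      rw [Function.update_of_ne (Finset.ne_of_mem_erase hi)]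
  simp only [key, Function.update_self]

/-- Existence of a best response forces the others' total to be positive in each shard. -/
lemma others_pos {M : ℕ} (P A : Fin M → ℝ) (c R : ℝ) (hP : ∀ m, 0 < P m)
    (hA : ∀ m, 0 ≤ A m) (hc : 0 < c) (hR : 0 < R) (x : Fin M → ℝ)
    (hx : x ∈ StrategySet M R)
    (hopt : ∀ y ∈ StrategySet M R, brU P A c y ≤ brU P A c x) (m : Fin M) : 0 < A m := by
  obtain ⟨hx0, hxR⟩ := hx
  by_contra hneg
  have hAm : A m = 0 := le_antisymm (not_lt.mp hneg) (hA m)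
  rcases (hx0 m).lt_or_eq with hpos | hzero
  · -- halve the contribution
    set y := Function.update x m (x m / 2) with hy
    have hsum : ∑ k, y k = ∑ k, x k - x m / 2 := by
      rw [← Finset.add_sum_erase Finset.univ y (Finset.mem_univ m),
        ← Finset.add_sum_erase Finset.univ x (Finset.mem_univ m)]
      have : ∑ k ∈ Finset.univ.erase m, y k = ∑ k ∈ Finset.univ.erase m, x k := by
        apply Finset.sum_congr rfl
        intro i hi
        rw [hy, Function.update_of_ne (Finset.ne_of_mem_erase hi)]
      rw [this, hy, Function.update_self]; ring
    have hmem : y ∈ StrategySet M R := by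
      refine ⟨fun k => ?_, by linarith⟩
      by_cases hk : k = m
      · subst hk; rw [hy, Function.update_self]; linarith
      · rw [hy, Function.update_of_ne hk]; exact hx0 k
    have h := hopt y hmem
    have hrew : ∀ k, P k * y k / (y k + A k) = P k * x k / (x k + A k) := by
      intro k
      by_cases hk : k = m
      · subst hk
        rw [hy, Function.update_self, hAm]
        field_simp
        simp
      · rw [hy, Function.update_of_ne hk]
    unfold brU at h
    simp only [hrew, hsum] at h
    nlinarith
  · have hxm : x m = 0 := hzero.symm
    set T := ∑ k, P k with hT
    have hTm : P m ≤ T := Finset.single_le_sum (fun k _ => (hP k).le) (Finset.mem_univ m)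
    have hTpos : 0 < T := lt_of_lt_of_le (hP m) hTm
    have hD : 0 < T + c * R := by positivity
    obtain ⟨s, hs0, hs1, hs⟩ : ∃ s : ℝ, 0 < s ∧ s < 1 ∧ s * (T + c * R) < P m := by
      refine ⟨P m / (2 * (T + c * R)), by have := hP m; positivity, ?_, ?_⟩
      · rw [div_lt_one (by positivity)]
        have : 0 < c * R := by positivity
        linarith
      · have := hP m
        have : P m / (2 * (T + c * R)) * (T + c * R) = P m / 2 := by field_simp
        linarith
    set y : Fin M → ℝ := fun k => (1 - s) * x k + (if k = m then s * R else 0) with hy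
    have hsum : ∑ k, y k = (1 - s) * ∑ k, x k + s * R := by
      simp [hy, Finset.sum_add_distrib, Finset.mul_sum]
    have hxs0 : 0 ≤ ∑ k, x k := Finset.sum_nonneg (fun k _ => hx0 k)
    have hmem : y ∈ StrategySet M R := by
      refine ⟨fun k => ?_, by rw [hsum]; nlinarith⟩
      have := mul_nonneg (sub_nonneg.mpr hs1.le) (hx0 k)
      have : 0 < s * R := by positivity
      simp only [hy]
      split_ifs <;> linarith
    have h := hopt y hmem
    have hterm : ∀ k, P k * x k / (x k + A k) + (if k = m then P m else 0) - s * P k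
        ≤ P k * y k / (y k + A k) := by
      intro k
      by_cases hk : k = m
      · subst hk
        have hsR : s * R ≠ 0 := by positivity
        have := mul_pos hs0 (hP k)
        simp only [hy, hxm, hAm]
        simp [hsR]
        linarith
      · simp only [hy, hk, if_false, add_zero]
        rcases (hx0 k).lt_or_eq with hk0 | hk0
        · have hPk := hP k
          have hAk := hA k
          have h1s : 0 < 1 - s := by linarith
          have e1 : P k * x k / (x k + A k) ≤ P k := by
            rw [div_le_iff₀ (by positivity)]; nlinarith
          have e2 : (1 - s) * (P k * x k / (x k + A k))
              ≤ P k * ((1 - s) * x k) / ((1 - s) * x k + A k) := by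
            rw [← mul_div_assoc, show (1 - s) * (P k * x k) = P k * ((1 - s) * x k) by ring]
            apply div_le_div_of_nonneg_left (by positivity) (by positivity)
            nlinarith
          nlinarith
        · rw [← hk0]
          have := mul_pos hs0 (hP k)
          simp
          exact this.le
    have hS := Finset.sum_le_sum (fun k (_ : k ∈ Finset.univ) => hterm k)
    rw [Finset.sum_sub_distrib, Finset.sum_add_distrib, ← Finset.mul_sum] at hS
    simp only [Finset.sum_ite_eq', Finset.mem_univ, if_true] at hS
    unfold brU at h
    rw [hsum] at h
    have : 0 ≤ c * s * ∑ k, x k := by positivity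
    nlinarith

/-- First-order (variational inequality) condition. -/
lemma foc {M : ℕ} (P A : Fin M → ℝ) (c R : ℝ)
    (hA : ∀ m, 0 < A m) (x y : Fin M → ℝ)
    (hx : x ∈ StrategySet M R) (hy : y ∈ StrategySet M R)
    (hopt : ∀ y ∈ StrategySet M R, brU P A c y ≤ brU P A c x) :
    ∑ m, (P m * (A m / (x m + A m) ^ 2) - c) * (y m - x m) ≤ 0 := by
  obtain ⟨hx0, hxR⟩ := hx
  obtain ⟨hy0, hyR⟩ := hy
  let F : ℝ → ℝ := fun s =>
    ∑ m, (P m * (A m / ((x m + A m) * (x m + s * (y m - x m) + A m))) - c) * (y m - x m)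
  have hF0 : F 0 = ∑ m, (P m * (A m / (x m + A m) ^ 2) - c) * (y m - x m) := by
    simp only [F]
    apply Finset.sum_congr rfl
    intro m _
    rw [zero_mul, add_zero, sq]
  have hcont : ContinuousAt F 0 := by
    simp only [F]
    refine tendsto_finsetSum _ (fun m _ => ?_)
    have : (x m + A m) * (x m + 0 * (y m - x m) + A m) ≠ 0 := by
      have := hx0 m
      have := hA m
      have : 0 < x m + A m := by linarith
      simp only [zero_mul, add_zero]
      positivity
    have hc : ContinuousAt (fun s : ℝ =>
      (P m * (A m / ((x m + A m) * (x m + s * (y m - x m) + A m))) - c) * (y m - x m)) 0 := by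
      fun_prop (disch := assumption)
    exact hc
  have hle : ∀ s ∈ Set.Ioo (0 : ℝ) 1, F s ≤ 0 := by
    rintro s ⟨hs0, hs1⟩
    have hz0 : ∀ m, 0 ≤ x m + s * (y m - x m) := by
      intro m
      nlinarith [hx0 m, hy0 m]
    have hmem : (fun m => x m + s * (y m - x m)) ∈ StrategySet M R := by
      refine ⟨hz0, ?_⟩
      rw [Finset.sum_add_distrib, ← Finset.mul_sum, Finset.sum_sub_distrib]
      nlinarith
    have h := hopt _ hmem
    have hd : brU P A c (fun m => x m + s * (y m - x m)) - brU P A c x = s * F s := by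
      simp only [brU, F]
      rw [Finset.mul_sum, Finset.mul_sum, Finset.mul_sum, ← Finset.sum_sub_distrib,
        ← Finset.sum_sub_distrib, ← Finset.sum_sub_distrib]
      apply Finset.sum_congr rfl
      intro m _
      have h1 : x m + A m ≠ 0 := by have := hx0 m; have := hA m; positivity
      have h2 : x m + s * (y m - x m) + A m ≠ 0 := by
        have := hz0 m; have := hA m; positivity
      field_simp
      ring
    by_contra hcon
    have := mul_pos hs0 (not_le.mp hcon)
    linarith
  rw [← hF0]
  refine le_of_tendsto (hcont.tendsto.mono_left nhdsWithin_le_nhds : Filter.Tendsto F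
    (nhdsWithin 0 (Set.Ioi 0)) _) ?_
  filter_upwards [Ioo_mem_nhdsGT (zero_lt_one : (0:ℝ) < 1)] with s hs using hle s hs

/-- Per-shard strict monotonicity. -/
lemma shard_mono {N : ℕ} (x y : Fin N → ℝ) (X Y : ℝ) (hX : 0 < X) (hY : 0 < Y)
    (hxX : ∑ i, x i = X) (hyY : ∑ i, y i = Y)
    (hx0 : ∀ i, 0 ≤ x i) (hy0 : ∀ i, 0 ≤ y i) (hxlt : ∀ i, x i < X) (hylt : ∀ i, y i < Y) :
    0 ≤ ∑ i, ((X - x i) / X ^ 2 - (Y - y i) / Y ^ 2) * (y i - x i) ∧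
    (∑ i, ((X - x i) / X ^ 2 - (Y - y i) / Y ^ 2) * (y i - x i) = 0 → x = y) := by
  obtain ⟨p, hp⟩ : ∃ p : Fin N → ℝ, ∀ i, x i = X * p i :=
    ⟨fun i => x i / X, fun i => by field_simp⟩
  obtain ⟨q, hq⟩ : ∃ q : Fin N → ℝ, ∀ i, y i = Y * q i :=
    ⟨fun i => y i / Y, fun i => by field_simp⟩
  have hp1 : ∑ i, p i = 1 := by
    have : X * ∑ i, p i = X := by
      rw [Finset.mul_sum]; simpa only [hp] using hxX
    exact mul_left_cancel₀ hX.ne' (by linarith)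
  have hq1 : ∑ i, q i = 1 := by
    have : Y * ∑ i, q i = Y := by
      rw [Finset.mul_sum]; simpa only [hq] using hyY
    exact mul_left_cancel₀ hY.ne' (by linarith)
  have hp0 : ∀ i, 0 ≤ p i := fun i => by
    have := hx0 i; rw [hp] at this; exact nonneg_of_mul_nonneg_right this hX
  have hq0 : ∀ i, 0 ≤ q i := fun i => by
    have := hy0 i; rw [hq] at this; exact nonneg_of_mul_nonneg_right this hY
  have hplt : ∀ i, p i < 1 := fun i => by
    have := hxlt i; rw [hp] at this; nlinarith
  have hD : 0 < 1 - ∑ i, p i * q i := by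
    have hle : ∀ i ∈ Finset.univ, p i * q i ≤ q i := fun i _ => by
      nlinarith [hplt i, hq0 i]
    obtain ⟨j, hj⟩ : ∃ j, 0 < q j := by
      by_contra hcon
      push Not at hcon
      have := Finset.sum_nonpos (fun i (_ : i ∈ Finset.univ) => hcon i)
      linarith
    have := Finset.sum_lt_sum hle ⟨j, Finset.mem_univ j, by nlinarith [hplt j]⟩
    linarith
  have hid : ∑ i, ((X - x i) / X ^ 2 - (Y - y i) / Y ^ 2) * (y i - x i)
      = ∑ i, (p i - q i) ^ 2 + (X - Y) ^ 2 / (X * Y) * (1 - ∑ i, p i * q i) := by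
    have e : ∀ i, ((X - x i) / X ^ 2 - (Y - y i) / Y ^ 2) * (y i - x i)
      = (p i - q i) ^ 2 - (X - Y) ^ 2 / (X * Y) * (p i * q i)
        + (X / Y - 1) * p i + (Y / X - 1) * q i := by
      intro i
      rw [hp, hq]
      field_simp
      ring
    simp only [e, Finset.sum_add_distrib, Finset.sum_sub_distrib, ← Finset.mul_sum, hp1, hq1]
    field_simp
    ring
  have hs1 : 0 ≤ ∑ i, (p i - q i) ^ 2 := Finset.sum_nonneg (fun i _ => sq_nonneg _)
  have hs2 : 0 ≤ (X - Y) ^ 2 / (X * Y) := by positivity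
  have hs3 := mul_nonneg hs2 hD.le
  rw [hid]
  refine ⟨by linarith, fun h0 => ?_⟩
  have z1 : ∑ i, (p i - q i) ^ 2 = 0 := by linarith
  have z2 : (X - Y) ^ 2 / (X * Y) * (1 - ∑ i, p i * q i) = 0 := by linarith
  have hXY : X = Y := by
    rcases mul_eq_zero.mp z2 with h | h
    · rcases div_eq_zero_iff.mp h with h | h
      · exact sub_eq_zero.mp (pow_eq_zero_iff (two_ne_zero) |>.mp h)
      · exact absurd h (by positivity)
    · exact absurd h hD.ne'
  rw [Finset.sum_eq_zero_iff_of_nonneg (fun i _ => sq_nonneg _)] at z1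
  funext i
  have := pow_eq_zero_iff (two_ne_zero) |>.mp (z1 i (Finset.mem_univ i))
  rw [hp, hq, hXY, sub_eq_zero.mp this]

lemma nash_facts {N M : ℕ} (R C : Fin N → ℝ) (P : Fin M → ℝ)
    (hR : ∀ n, 0 < R n) (hC : ∀ n, 0 < C n) (hP : ∀ m, 0 < P m)
    (r : Fin N → Fin M → ℝ) (h : IsNashEquilibrium R C P r) :
    (∀ n m, r n m < ∑ i, r i m) ∧
    ∀ n, ∀ y ∈ StrategySet M (R n),
      ∑ m, (P m * ((∑ i, r i m - r n m) / (∑ i, r i m) ^ 2) - C n) * (y m - r n m) ≤ 0 := by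
  obtain ⟨hmem, hbest⟩ := h
  have hopt : ∀ n, ∀ y ∈ StrategySet M (R n),
      brU P (fun m => ∑ i ∈ Finset.univ.erase n, r i m) (C n) y
        ≤ brU P (fun m => ∑ i ∈ Finset.univ.erase n, r i m) (C n) (r n) := by
    intro n y hy
    have := hbest n y hy
    rw [utility_update_eq] at this
    have e := utility_update_eq P C r n (r n)
    rw [Function.update_eq_self] at e
    rwa [e] at this
  have hpos : ∀ n m, 0 < ∑ i ∈ Finset.univ.erase n, r i m := fun n m =>
    others_pos P _ (C n) (R n) hP
      (fun m => Finset.sum_nonneg (fun i _ => (hmem i).1 m)) (hC n) (hR n) (r n)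
      (hmem n) (hopt n) m
  have hsplit : ∀ n m, r n m + ∑ i ∈ Finset.univ.erase n, r i m = ∑ i, r i m := fun n m =>
    Finset.add_sum_erase Finset.univ (fun i => r i m) (Finset.mem_univ n)
  refine ⟨fun n m => by linarith [hpos n m, hsplit n m], fun n y hy => ?_⟩
  have := foc P _ (C n) (R n) (hpos n) (r n) y (hmem n) hy (hopt n)
  have e : ∀ m, ∑ i ∈ Finset.univ.erase n, r i m = ∑ i, r i m - r n m := fun m => by
    linarith [hsplit n m]
  simp only [hsplit] at this
  simpa only [e] using this

/-- **Uniqueness of the Nash equilibrium in the followers' sub-game `G_F`.**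
If `r*` and `r**` are both Nash equilibria, then `r* = r**`. -/
theorem followers_subgame_nash_equilibrium_unique
    (N M : ℕ) (hN : 2 ≤ N) (hM : 1 ≤ M)
    (R C : Fin N → ℝ) (P : Fin M → ℝ)
    (hR : ∀ n, 0 < R n) (hC : ∀ n, 0 < C n) (hP : ∀ m, 0 < P m)
    (rstar rstarstar : Fin N → Fin M → ℝ)
    (h1 : IsNashEquilibrium R C P rstar)
    (h2 : IsNashEquilibrium R C P rstarstar) :
    rstar = rstarstar := by
  obtain ⟨l1, v1⟩ := nash_facts R C P hR hC hP rstar h1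
  obtain ⟨l2, v2⟩ := nash_facts R C P hR hC hP rstarstar h2
  have n0 : Fin N := ⟨0, by omega⟩
  have key : ∀ m, _ := fun m => shard_mono (fun i => rstar i m) (fun i => rstarstar i m)
    (∑ i, rstar i m) (∑ i, rstarstar i m)
    (lt_of_le_of_lt ((h1.1 n0).1 m) (l1 n0 m)) (lt_of_le_of_lt ((h2.1 n0).1 m) (l2 n0 m))
    rfl rfl (fun i => (h1.1 i).1 m) (fun i => (h2.1 i).1 m) (fun i => l1 i m) (fun i => l2 i m)
  have hsum : ∑ m, P m * ∑ n, ((∑ i, rstar i m - rstar n m) / (∑ i, rstar i m) ^ 2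
      - (∑ i, rstarstar i m - rstarstar n m) / (∑ i, rstarstar i m) ^ 2)
        * (rstarstar n m - rstar n m) ≤ 0 := by
    simp only [Finset.mul_sum]
    rw [Finset.sum_comm]
    apply Finset.sum_nonpos
    intro n _
    have a := v1 n _ (h2.1 n)
    have b := v2 n _ (h1.1 n)
    have := add_nonpos a b
    rw [← Finset.sum_add_distrib] at this
    refine le_trans (le_of_eq ?_) this
    apply Finset.sum_congr rfl
    intro m _
    ring
  have hnn : ∀ m ∈ Finset.univ, 0 ≤ P m * ∑ n, ((∑ i, rstar i m - rstar n m)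
      / (∑ i, rstar i m) ^ 2
      - (∑ i, rstarstar i m - rstarstar n m) / (∑ i, rstarstar i m) ^ 2)
        * (rstarstar n m - rstar n m) := fun m _ => mul_nonneg (hP m).le (key m).1
  have hz := (Finset.sum_eq_zero_iff_of_nonneg hnn).mp (le_antisymm hsum (Finset.sum_nonneg hnn))
  funext n m
  have hm := (mul_eq_zero.mp (hz m (Finset.mem_univ m))).resolve_left (hP m).ne'
  exact congrFun ((key m).2 hm) n
end

section
/- Fix a follower n, and fix the strategies of all other followers so that for every shard m the combined contribution of the other followers T_m = Σ_{i ≠ n} r_i^m is strictly positive. Then the function r_n ↦ U_n(r_n) = Σ_{m=1}^M P_m · r_n^m / (r_n^m + T_m) − C_n · Σ_{m=1}^M r_n^m is strictly concave on the strategy set S_n. -/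
open scoped BigOperators

/-- The exact Jensen gap of `x ↦ p x / (x + t)`. -/
lemma shard_gap (p t x y a b : ℝ) (ht : 0 < t) (hx : 0 ≤ x) (hy : 0 ≤ y)
    (ha : 0 < a) (hb : 0 < b) (hab : a + b = 1) :
    p * (a * x + b * y) / (a * x + b * y + t)
      = a * (p * x / (x + t)) + b * (p * y / (y + t))
        + p * t * a * b * (x - y) ^ 2 / ((x + t) * (y + t) * (a * x + b * y + t)) := by
  have h1 : x + t ≠ 0 := by positivity
  have h2 : y + t ≠ 0 := by positivity
  have h3 : a * x + b * y + t ≠ 0 := by positivity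
  obtain rfl : b = 1 - a := by linarith
  field_simp
  ring

/-- **Strict concavity of a follower's utility.**
Fixing the other followers' contributions `T m > 0` on each shard, follower `n`'s utility
`r ↦ ∑ m, P m · r m / (r m + T m) − C_n · ∑ m, r m` is strictly concave on its strategy
set `S_n`. -/
theorem follower_utility_strictConcaveOn
    (M : ℕ) (hM : 1 ≤ M) (P T : Fin M → ℝ) (Rn Cn : ℝ)
    (hP : ∀ m, 0 < P m) (hT : ∀ m, 0 < T m) (hR : 0 < Rn) (hC : 0 < Cn) :
    StrictConcaveOn ℝ (StrategySet M Rn)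
      (fun r : Fin M → ℝ => ∑ m, P m * r m / (r m + T m) - Cn * ∑ m, r m) := by
  refine ⟨?_, ?_⟩
  · rintro x ⟨hx, hxs⟩ y ⟨hy, hys⟩ a b ha hb hab
    refine ⟨fun m => ?_, ?_⟩
    · have := hx m
      have := hy m
      simp only [Pi.add_apply, Pi.smul_apply, smul_eq_mul]
      positivity
    · simp only [Pi.add_apply, Pi.smul_apply, smul_eq_mul, Finset.sum_add_distrib,
        ← Finset.mul_sum]
      obtain rfl : b = 1 - a := by linarith
      nlinarith
  · rintro x ⟨hx, hxs⟩ y ⟨hy, hys⟩ hxy a b ha hb hab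
    obtain ⟨k, hk⟩ := Function.ne_iff.mp hxy
    have key : ∑ m, (a * (P m * x m / (x m + T m)) + b * (P m * y m / (y m + T m)))
        < ∑ m, P m * (a * x m + b * y m) / (a * x m + b * y m + T m) := by
      apply Finset.sum_lt_sum
      · intro m _
        rw [shard_gap (P m) (T m) (x m) (y m) a b (hT m) (hx m) (hy m) ha hb hab]
        have := hx m
        have := hy m
        have := hT m
        have := hP m
        exact le_add_of_nonneg_right (by positivity)
      · refine ⟨k, Finset.mem_univ k, ?_⟩
        rw [shard_gap (P k) (T k) (x k) (y k) a b (hT k) (hx k) (hy k) ha hb hab]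
        have := hx k
        have := hy k
        have := hT k
        have := hP k
        have : x k - y k ≠ 0 := sub_ne_zero.mpr hk
        exact lt_add_of_pos_right _ (by positivity)
    simp only [Pi.add_apply, Pi.smul_apply, smul_eq_mul]
    simp only [Finset.sum_add_distrib, ← Finset.mul_sum] at key ⊢
    linarith
end

section
/- Fix a follower n, and fix the strategies of all other followers so that for every shard m the combined contribution of the other followers T_m = Σ_{i ≠ n} r_i^m is strictly positive. Then follower n has a unique best response: there exists exactly one r*_n in the strategy set S_n such that U_n(r*_n) ≥ U_n(r'_n) for all r'_n ∈ S_n. -/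
open scoped BigOperators

/-- Exact midpoint-concavity defect of the payment share. -/
theorem share_midpoint (p t x y : ℝ) (ht : 0 < t) (hx : 0 ≤ x) (hy : 0 ≤ y) :
    p * ((x + y) / 2) / ((x + y) / 2 + t) =
      (p * x / (x + t) + p * y / (y + t)) / 2 +
        p * t * (x - y) ^ 2 / (2 * (x + t) * (y + t) * (x + y + 2 * t)) := by
  have h1 : x + t ≠ 0 := by positivity
  have h2 : y + t ≠ 0 := by positivity
  have h3 : x + y + 2 * t ≠ 0 := by positivity
  have h4 : (x + y) / 2 + t = (x + y + 2 * t) / 2 := by ring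
  rw [h4]
  field_simp
  ring

theorem strategySet_isCompact (M : ℕ) (Rn : ℝ) : IsCompact (StrategySet M Rn) := by
  have hsub : StrategySet M Rn ⊆ Set.Icc (fun _ => (0 : ℝ)) (fun _ => Rn) := by
    rintro r ⟨h0, hs⟩
    refine ⟨fun m => h0 m, fun m => ?_⟩
    exact (Finset.single_le_sum (fun i _ => h0 i) (Finset.mem_univ m)).trans hs
  refine isCompact_Icc.of_isClosed_subset ?_ hsub
  have : StrategySet M Rn = (⋂ m, {r : Fin M → ℝ | 0 ≤ r m}) ∩ {r | ∑ m, r m ≤ Rn} := by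
    ext r
    simp [StrategySet]
  rw [this]
  refine (isClosed_iInter fun m => ?_).inter ?_
  · exact isClosed_le continuous_const (continuous_apply m)
  · exact isClosed_le (by fun_prop) continuous_const

/-- **Existence and uniqueness of a follower's best response.**
Fixing the other followers' contributions `T m > 0` on each shard, follower `n` has exactly
one best response in its strategy set `S_n`, i.e. exactly one strategy maximizing its
utility `U_n` over `S_n`. -/
theorem follower_unique_best_response
    (M : ℕ) (hM : 1 ≤ M) (P T : Fin M → ℝ) (Rn Cn : ℝ)
    (hP : ∀ m, 0 < P m) (hT : ∀ m, 0 < T m) (hR : 0 < Rn) (hC : 0 < Cn) :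
    ∃! rstar : Fin M → ℝ, rstar ∈ StrategySet M Rn ∧
      ∀ r' ∈ StrategySet M Rn,
        (∑ m, P m * r' m / (r' m + T m) - Cn * ∑ m, r' m) ≤
          (∑ m, P m * rstar m / (rstar m + T m) - Cn * ∑ m, rstar m) := by
  have hcont : ContinuousOn (fun r : Fin M → ℝ =>
      ∑ m, P m * r m / (r m + T m) - Cn * ∑ m, r m) (StrategySet M Rn) := by
    refine ContinuousOn.sub (continuousOn_finsetSum _ fun m _ => ?_) (by fun_prop)
    refine ContinuousOn.div (by fun_prop) (by fun_prop) ?_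
    intro r hr
    have := hr.1 m
    have := hT m
    positivity
  have hne : (StrategySet M Rn).Nonempty := ⟨fun _ => 0, by simp [StrategySet, hR.le]⟩
  obtain ⟨r, hr, hmax⟩ := (strategySet_isCompact M Rn).exists_isMaxOn hne hcont
  refine ⟨r, ⟨hr, fun r' hr' => hmax hr'⟩, ?_⟩
  rintro q ⟨hq, hqmax⟩
  by_contra hqr
  obtain ⟨k, hk⟩ := Function.ne_iff.mp hqr
  have hsum : ∑ m, (q m + r m) / 2 = (∑ m, q m + ∑ m, r m) / 2 := by
    rw [← Finset.sum_div, Finset.sum_add_distrib]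
  have hmid : (fun m => (q m + r m) / 2) ∈ StrategySet M Rn := by
    refine ⟨fun m => ?_, ?_⟩
    · have := hq.1 m
      have := hr.1 m
      positivity
    · rw [hsum]
      linarith [hq.2, hr.2]
  have h1 := hqmax _ hmid
  have h2 := hqmax r hr
  have h3 : (∑ m, P m * q m / (q m + T m) - Cn * ∑ m, q m) ≤
      (∑ m, P m * r m / (r m + T m) - Cn * ∑ m, r m) := hmax hq
  have hlt : ∑ m, (P m * q m / (q m + T m) + P m * r m / (r m + T m)) / 2 <
      ∑ m, P m * ((q m + r m) / 2) / ((q m + r m) / 2 + T m) := by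
    refine Finset.sum_lt_sum (fun m _ => ?_) ⟨k, Finset.mem_univ k, ?_⟩
    · rw [share_midpoint _ _ _ _ (hT m) (hq.1 m) (hr.1 m)]
      have := hq.1 m
      have := hr.1 m
      have := hT m
      have := hP m
      exact le_add_of_nonneg_right (by positivity)
    · rw [share_midpoint _ _ _ _ (hT k) (hq.1 k) (hr.1 k)]
      have := hq.1 k
      have := hr.1 k
      have := hT k
      have := hP k
      have : q k - r k ≠ 0 := sub_ne_zero.mpr hk
      exact lt_add_of_pos_right _ (by positivity)
  rw [← Finset.sum_div, Finset.sum_add_distrib] at hlt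
  simp only [hsum] at h1
  have hlin : Cn * ((∑ m, q m + ∑ m, r m) / 2) =
      (Cn * ∑ m, q m + Cn * ∑ m, r m) / 2 := by ring
  rw [hlin] at h1
  linarith
end

section
/- Let P > 0, T > 0, C > 0, and R > 0 be real numbers, and let φ(x) = P · x / (x + T) − C · x. Then φ attains its maximum over the interval [0, R] at the unique point x* = min(R, max(0, √(PT/C) − T)), and this maximizer is unique: φ(x*) > φ(x) for all x ∈ [0, R] with x ≠ x*. -/
/-- **The unique optimal contribution of a follower to a single shard.**
For `P, T, C, R > 0` and `φ(x) = P·x/(x+T) − C·x`, the function `φ` attains its maximum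
over `[0, R]` at the unique point `x* = min R (max 0 (√(PT/C) − T))`: for every
`x ∈ [0, R]` different from `x*`, `φ(x) < φ(x*)`. -/
theorem unique_optimal_contribution (P T C R : ℝ)
    (hP : 0 < P) (hT : 0 < T) (hC : 0 < C) (hR : 0 < R) :
    min R (max 0 (Real.sqrt (P * T / C) - T)) ∈ Set.Icc (0 : ℝ) R ∧
      ∀ x ∈ Set.Icc (0 : ℝ) R, x ≠ min R (max 0 (Real.sqrt (P * T / C) - T)) →
        P * x / (x + T) - C * x <
          P * min R (max 0 (Real.sqrt (P * T / C) - T)) /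
              (min R (max 0 (Real.sqrt (P * T / C) - T)) + T) -
            C * min R (max 0 (Real.sqrt (P * T / C) - T)) := by
  have hs0 : 0 < P * T / C := by positivity
  have hsq : Real.sqrt (P * T / C) ^ 2 = P * T / C := Real.sq_sqrt hs0.le
  have hs : 0 < Real.sqrt (P * T / C) := Real.sqrt_pos.mpr hs0
  have hPT : P * T = C * Real.sqrt (P * T / C) ^ 2 := by
    rw [hsq]; field_simp
  generalize Real.sqrt (P * T / C) = s at *
  have hy0 : 0 ≤ min R (max 0 (s - T)) := le_min hR.le (le_max_left _ _)
  have hyR : min R (max 0 (s - T)) ≤ R := min_le_left _ _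
  have hlow : ∀ x, 0 ≤ x → x < min R (max 0 (s - T)) → min R (max 0 (s - T)) ≤ s - T := by
    intro x hx h
    have h1 := lt_of_lt_of_le h (min_le_right _ _)
    rcases lt_max_iff.mp h1 with h2 | h2
    · linarith
    · exact (min_le_right _ _).trans (max_le (by linarith) le_rfl)
  have hhigh : ∀ x, x ≤ R → min R (max 0 (s - T)) < x → s - T ≤ min R (max 0 (s - T)) := by
    intro x hx h
    rcases min_choice R (max 0 (s - T)) with h1 | h1
    · linarith
    · rw [h1]; exact le_max_right _ _
  generalize min R (max 0 (s - T)) = y at *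
  refine ⟨⟨hy0, hyR⟩, ?_⟩
  rintro x ⟨hx0, hxR⟩ hne
  have hxT : 0 < x + T := by linarith
  have hyT : 0 < y + T := by linarith
  have key : (P * y / (y + T) - C * y) - (P * x / (x + T) - C * x)
      = C * ((y - x) * (s ^ 2 - (x + T) * (y + T))) / ((x + T) * (y + T)) := by
    field_simp
    linear_combination (y - x) * hPT
  have hpos : 0 < (y - x) * (s ^ 2 - (x + T) * (y + T)) := by
    rcases lt_or_gt_of_ne hne with h | h
    · have h1 := hlow x hx0 h
      apply mul_pos (by linarith)
      nlinarith
    · have h1 := hhigh x hxR h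
      apply mul_pos_of_neg_of_neg (by linarith)
      nlinarith
  have : 0 < C * ((y - x) * (s ^ 2 - (x + T) * (y + T))) / ((x + T) * (y + T)) := by
    positivity
  linarith
end

section
/- Consider the single-shard followers' game with N ≥ 2 followers, payment P > 0, and costs C_1, ..., C_N > 0, and let r = (r_1, ..., r_N) be a profile with r_n > 0 for all n; set S = Σ_{i=1}^N r_i. Let g_n(r) = P (S − r_n)/S^2 − C_n be the pseudogradient (the partial derivative of U_n with respect to r_n), and let J be the N×N Jacobian matrix J_{nj} = ∂g_n/∂r_j, whose entries are J_{nn} = −2P(S − r_n)/S^3 and J_{nj} = P(S − 2(S − r_n))/S^3 for j ≠ n. Then the symmetrized matrix J + Jᵀ is negative definite. -/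
open scoped BigOperators
open Matrix

/-- **Negative definiteness of the symmetrized Jacobian of the pseudogradient**
(the condition used in Rosen's theorem).  In the single-shard followers' game, at any
profile `r` with `r n > 0` for all `n` (with `S = ∑ i, r i`), the Jacobian `J` of the
pseudogradient `g_n(r) = P (S − r_n)/S² − C_n` has entries
`J n n = −2P(S − r_n)/S³` and `J n j = P(S − 2(S − r_n))/S³` for `j ≠ n`,
and the symmetrized matrix `J + Jᵀ` is negative definite. -/
theorem symmetrized_jacobian_negative_definite
    (N : ℕ) (hN : 2 ≤ N) (P : ℝ) (hP : 0 < P) (C : Fin N → ℝ) (hC : ∀ n, 0 < C n)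
    (r : Fin N → ℝ) (hr : ∀ n, 0 < r n)
    (S : ℝ) (hS : S = ∑ i, r i)
    (J : Matrix (Fin N) (Fin N) ℝ)
    (hJ : ∀ n j, J n j =
      if n = j then -2 * P * (S - r n) / S ^ 3
      else P * (S - 2 * (S - r n)) / S ^ 3) :
    ∀ v : Fin N → ℝ, v ≠ 0 → v ⬝ᵥ (J + J.transpose).mulVec v < 0 := by
  intro v hv
  have hJ' : ∀ n j, J n j = P / S ^ 3 * (2 * r n - S - if n = j then S else 0) := by
    intro n j
    rw [hJ]
    split_ifs <;> ring
  have hlt : ∀ n, r n < S := by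
    intro n
    haveI : Nontrivial (Fin N) := Fin.nontrivial_iff_two_le.mpr hN
    obtain ⟨m, hm⟩ := exists_ne n
    rw [hS]
    exact Finset.single_lt_sum hm (Finset.mem_univ n) (Finset.mem_univ m) (hr m)
      (fun k _ _ => (hr k).le)
  have n0 : Fin N := ⟨0, by omega⟩
  have hSpos : 0 < S := (hr n0).trans (hlt n0)
  have hr2 : ∑ i, r i ^ 2 < S ^ 2 := by
    calc ∑ i, r i ^ 2 < ∑ i, r i * S := by
          apply Finset.sum_lt_sum_of_nonempty ⟨n0, Finset.mem_univ n0⟩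
          intro i _
          nlinarith [hr i, hlt i]
      _ = S ^ 2 := by rw [← Finset.sum_mul, ← hS]; ring
  have hQ : 0 < ∑ i, v i ^ 2 := by
    obtain ⟨m, hm⟩ := Function.ne_iff.mp hv
    have hm' : v m ≠ 0 := hm
    exact Finset.sum_pos' (fun i _ => sq_nonneg _) ⟨m, Finset.mem_univ m, by positivity⟩
  have hCS := Finset.sum_mul_sq_le_sq_mul_sq Finset.univ r v
  have hin : ∀ n, ∑ j, J n j * v j
      = P / S ^ 3 * ((2 * r n - S) * (∑ j, v j) - S * v n) := by
    intro n
    simp only [hJ', mul_assoc, ← Finset.mul_sum, sub_mul _ (ite _ _ _), Finset.sum_sub_distrib,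
      ite_mul, zero_mul, Finset.sum_ite_eq, Finset.mem_univ, if_true]
  have hquad : v ⬝ᵥ J.mulVec v = P / S ^ 3 *
      (2 * (∑ i, r i * v i) * (∑ i, v i) - S * (∑ i, v i) ^ 2 - S * ∑ i, v i ^ 2) := by
    have h1 : v ⬝ᵥ J.mulVec v = ∑ n, v n * ∑ j, J n j * v j := rfl
    rw [h1]
    simp only [hin]
    generalize hV : ∑ j, v j = V
    have h2 : ∀ n, v n * (P / S ^ 3 * ((2 * r n - S) * V - S * v n))
        = P / S ^ 3 * (2 * V * (r n * v n) - S * V * v n - S * v n ^ 2) := by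
      intro n; ring
    simp only [h2]
    rw [← Finset.mul_sum, Finset.sum_sub_distrib, Finset.sum_sub_distrib, ← Finset.mul_sum,
      ← Finset.mul_sum, ← Finset.mul_sum, hV]
    ring
  have hT : v ⬝ᵥ J.transpose.mulVec v = v ⬝ᵥ J.mulVec v := by
    rw [Matrix.mulVec_transpose, dotProduct_comm, ← Matrix.dotProduct_mulVec]
  rw [Matrix.add_mulVec, dotProduct_add, hT, hquad]
  generalize ∑ i, r i * v i = R at *
  generalize ∑ i, v i = V at *
  generalize ∑ i, v i ^ 2 = Q at *
  have hneg : 2 * R * V - S * V ^ 2 - S * Q < 0 := by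
    have h3 : S * (2 * R * V - S * V ^ 2 - S * Q) < 0 := by
      nlinarith [sq_nonneg (S * V - R), mul_lt_mul_of_pos_right hr2 hQ]
    exact (pos_iff_neg_of_mul_neg h3).mp hSpos
  have hpos : 0 < P / S ^ 3 := by positivity
  have := mul_neg_of_pos_of_neg hpos hneg
  linarith
end

section
/- Consider the single-shard followers' game with N ≥ 2 followers, payment P > 0, and costs C_1, ..., C_N > 0. Let g(r) ∈ ℝ^N denote the pseudogradient with components g_n(r) = P (S − r_n)/S^2 − C_n, where S = Σ_{i=1}^N r_i. Then g is strictly monotone decreasing on the open positive orthant: for any two distinct profiles r, r' ∈ ℝ^N with all components strictly positive, ⟨g(r) − g(r'), r − r'⟩ < 0 (equivalently, the game is diagonally strictly concave with unit weights on the positive orthant). -/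
open scoped BigOperators

/-- **Strict monotonicity (diagonal strict concavity) of the pseudogradient** in the
single-shard followers' game.  With `g_n(r) = P (S − r_n)/S² − C_n` where `S = ∑ i, r i`,
for any two distinct profiles `r, r'` with all components strictly positive we have
`⟨g(r) − g(r'), r − r'⟩ < 0`. -/
theorem pseudogradient_strictly_monotone_decreasing
    (N : ℕ) (hN : 2 ≤ N) (P : ℝ) (hP : 0 < P) (C : Fin N → ℝ) (hC : ∀ n, 0 < C n)
    (r r' : Fin N → ℝ) (hr : ∀ n, 0 < r n) (hr' : ∀ n, 0 < r' n) (hne : r ≠ r') :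
    ∑ n, ((P * ((∑ i, r i) - r n) / (∑ i, r i) ^ 2 - C n) -
          (P * ((∑ i, r' i) - r' n) / (∑ i, r' i) ^ 2 - C n)) * (r n - r' n) < 0 := by
  obtain ⟨n0, hn0⟩ := Function.ne_iff.mp hne
  have hS : 0 < ∑ i, r i := Finset.sum_pos (fun i _ => hr i) ⟨n0, Finset.mem_univ _⟩
  have hT : 0 < ∑ i, r' i := Finset.sum_pos (fun i _ => hr' i) ⟨n0, Finset.mem_univ _⟩
  have hX : ∑ n, r n * r' n < (∑ i, r i) * (∑ i, r' i) := by
    rw [Finset.sum_mul]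
    refine Finset.sum_lt_sum_of_nonempty ⟨n0, Finset.mem_univ _⟩ fun n _ => ?_
    refine mul_lt_mul_of_pos_left ?_ (hr n)
    haveI : Nontrivial (Fin N) := Fin.nontrivial_iff_two_le.mpr hN
    obtain ⟨m, hm⟩ := exists_ne n
    exact Finset.single_lt_sum hm (Finset.mem_univ n) (Finset.mem_univ m) (hr' m)
      (fun k _ _ => (hr' k).le)
  have hd1 : ∑ n, (r n - r' n) = (∑ i, r i) - ∑ i, r' i := Finset.sum_sub_distrib ..
  generalize hSd : ∑ i, r i = S at *
  generalize hTd : ∑ i, r' i = T at *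
  have hQ : ∑ n, (T * r n - S * r' n) ^ 2 =
      T ^ 2 * ∑ n, r n ^ 2 - 2 * S * T * ∑ n, r n * r' n + S ^ 2 * ∑ n, r' n ^ 2 := by
    simp only [Finset.mul_sum, ← Finset.sum_sub_distrib, ← Finset.sum_add_distrib]
    exact Finset.sum_congr rfl fun n _ => by ring
  have key : ∑ n, ((P * (S - r n) / S ^ 2 - C n) - (P * (T - r' n) / T ^ 2 - C n)) *
      (r n - r' n) = -(P / (S ^ 2 * T ^ 2)) *
        ((S - T) ^ 2 * (S * T - ∑ n, r n * r' n) + ∑ n, (T * r n - S * r' n) ^ 2) := by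
    have h1 : ∑ n, ((P * (S - r n) / S ^ 2 - C n) - (P * (T - r' n) / T ^ 2 - C n)) *
        (r n - r' n) = (P / (S ^ 2 * T ^ 2)) * (S * T * (T - S) * ∑ n, (r n - r' n)
          - T ^ 2 * ∑ n, r n ^ 2 + (S ^ 2 + T ^ 2) * ∑ n, r n * r' n
          - S ^ 2 * ∑ n, r' n ^ 2) := by
      simp only [Finset.mul_sum, ← Finset.sum_sub_distrib, ← Finset.sum_add_distrib]
      refine Finset.sum_congr rfl fun n _ => ?_
      field_simp
      ring
    rw [h1, hd1, hQ]
    ring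
  rw [key, neg_mul, neg_lt_zero]
  refine mul_pos (by positivity) ?_
  have hQ0 : 0 ≤ ∑ n, (T * r n - S * r' n) ^ 2 := Finset.sum_nonneg fun n _ => sq_nonneg _
  by_cases hST : S = T
  · subst hST
    have : 0 < ∑ n, (S * r n - S * r' n) ^ 2 := by
      refine Finset.sum_pos' (fun n _ => sq_nonneg _) ⟨n0, Finset.mem_univ _, ?_⟩
      rw [← mul_sub]
      have := sub_ne_zero.mpr hn0
      positivity
    simpa using this
  · have h1 := sub_ne_zero.mpr hST
    have h2 : 0 < S * T - ∑ n, r n * r' n := sub_pos.mpr hX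
    positivity
end
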